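/- Suppose A generates an n-times integrated group bounded by M(1+|t|^m) (integers m ≥ n ≥ 0), with σ(A) = {iλ_k : k ∈ ℤ, k ≠ 0} as in the spectral assumption (in particular 0 ∈ ρ(A), so A⁻¹ ∈ L(E)), and let P_k be the associated Riesz projections. Then there exists a bounded operator Q ∈ L(E) such that: (i) Q(P_k x) = A^{−(m+1)} P_k x for every k ≥ 1 and every x ∈ E; (ii) Q(P_k x) = 0 for every k ≤ −1 and every x ∈ E; (iii) Q ∘ Q = Q ∘ A^{−(m+1)}, where A^{−(m+1)} := (A⁻¹)^{m+1}. -/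

import Mathlib

open MeasureTheory Complex Filter Topology Metric

namespace SpectralDecomp

variable {G : Type*} [NormedAddCommGroup G] [NormedSpace ℂ G]

/-- `R` is the bounded inverse of `z • I - A`. -/
structure ResolventAt (A : G →ₗ.[ℂ] G) (z : ℂ) (R : G →L[ℂ] G) : Prop where
  mem : ∀ y : G, R y ∈ A.domain
  solves : ∀ y : G, z • R y - A ⟨R y, mem y⟩ = y
  leftInv : ∀ x : A.domain, R (z • (x : G) - A x) = x

/-- The resolvent set of the (unbounded) operator `A`. -/
def resolventSet (A : G →ₗ.[ℂ] G) : Set ℂ :=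
  {z : ℂ | ∃ R : G →L[ℂ] G, ResolventAt A z R}

/-- The spectrum of the (unbounded) operator `A`. -/
def spectrumSet (A : G →ₗ.[ℂ] G) : Set ℂ := (resolventSet A)ᶜ

/-- Membership in the domain of `A ^ j`. -/
def InDomPow (A : G →ₗ.[ℂ] G) : ℕ → G → Prop
  | 0, _ => True
  | j + 1, x => ∃ h : x ∈ A.domain, InDomPow A j (A ⟨x, h⟩)

/-- The value `A ^ j x` for `x ∈ D(A ^ j)`. -/
noncomputable def powApply (A : G →ₗ.[ℂ] G) : (j : ℕ) → (x : G) → InDomPow A j x → G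
  | 0, x, _ => x
  | j + 1, x, h => powApply A j (A ⟨x, h.choose⟩) h.choose_spec

/-- `A` generates an `n`-times integrated group `(Sp, Sm)` bounded by `M * (1 + |t| ^ m)`. -/
def Generates (A : G →ₗ.[ℂ] G) (n m : ℕ) (M : ℝ) (Sp Sm : ℝ → G →L[ℂ] G) : Prop :=
  (∀ x : G, ContinuousOn (fun t : ℝ => Sp t x) (Set.Ici 0)) ∧
  (∀ x : G, ContinuousOn (fun t : ℝ => Sm t x) (Set.Ici 0)) ∧
  (∀ t : ℝ, 0 ≤ t → ‖Sp t‖ ≤ M * (1 + t ^ m)) ∧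
  (∀ t : ℝ, 0 ≤ t → ‖Sm t‖ ≤ M * (1 + t ^ m)) ∧
  (∀ z : ℂ, 0 < z.re →
    (∃ R : G →L[ℂ] G, ResolventAt A z R ∧
      ∀ x : G, R x = z ^ n • ∫ t in Set.Ioi (0 : ℝ), Complex.exp (-z * t) • Sp t x) ∧
    (∃ R : G →L[ℂ] G, ResolventAt A (-z) R ∧
      ∀ x : G, -(R x) = z ^ n • ∫ t in Set.Ioi (0 : ℝ), Complex.exp (-z * t) • Sm t x))

/-- The Riesz projection associated to the circle of centre `c` and radius `ρ`,
built from the resolvent function `Rres`. -/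
noncomputable def rieszProj (Rres : ℂ → G →L[ℂ] G) (c : ℂ) (ρ : ℝ) : G →L[ℂ] G :=
  (2 * Real.pi * Complex.I)⁻¹ • (∮ z in C(c, ρ), Rres z)

theorem integrable_of_norm_le_div_sq {F : Type*} [NormedAddCommGroup F] {f : ℝ → F}
    (hf : Continuous f) {C : ℝ} (hC : ∀ s : ℝ, 1 ≤ |s| → ‖f s‖ ≤ C / s ^ 2) : Integrable f := by
  obtain ⟨K, hK⟩ := (isCompact_Icc (a := (-1 : ℝ)) (b := 1)).exists_bound_of_continuousOn
    hf.continuousOn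
  refine (integrable_inv_one_add_sq.const_mul (2 * max C K)).mono' hf.aestronglyMeasurable
    (Eventually.of_forall fun s => ?_)
  rcases le_total 1 |s| with h | h
  · have h1 : 1 ≤ s ^ 2 := by rw [← sq_abs]; nlinarith
    have hC0 : 0 ≤ C := by
      have := (norm_nonneg _).trans (hC s h)
      by_contra! hneg
      exact absurd this (not_le.mpr (div_neg_of_neg_of_pos hneg (by linarith)))
    refine (hC s h).trans ?_
    rw [← div_eq_mul_inv, div_le_div_iff₀ (by linarith) (by linarith)]
    nlinarith [le_max_left C K]
  · have h1 : s ^ 2 ≤ 1 := by rw [← sq_abs]; nlinarith [abs_nonneg s]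
    have hs := hK s (Set.mem_Icc.mpr (abs_le.mp h))
    have hK0 : 0 ≤ K := (norm_nonneg _).trans hs
    refine hs.trans ?_
    rw [← div_eq_mul_inv, le_div_iff₀ (by positivity)]
    nlinarith [le_max_right C K]

/-- The parametrization of the horizontal line of imaginary part `ε`. -/
noncomputable def line (ε s : ℝ) : ℂ := s + ε * I

@[simp] theorem line_re (ε s : ℝ) : (line ε s).re = s := by simp [line]

@[simp] theorem line_im (ε s : ℝ) : (line ε s).im = ε := by simp [line]

theorem hasDerivAt_line (ε s : ℝ) : HasDerivAt (line ε) 1 s :=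
  (Complex.ofRealCLM.hasDerivAt (x := s)).add_const _

theorem continuous_line (ε : ℝ) : Continuous (line ε) := by unfold line; fun_prop

theorem line_ne_zero {ε : ℝ} (hε : 0 < ε) (s : ℝ) : line ε s ≠ 0 := fun h => by
  have := congrArg Complex.im h
  simp at this; linarith

theorem abs_le_norm_line (ε s : ℝ) : |s| ≤ ‖line ε s‖ := by
  simpa using Complex.abs_re_le_norm (line ε s)

theorem continuous_line_inv_pow {ε : ℝ} (hε : 0 < ε) (j : ℕ) :
    Continuous fun s : ℝ => (line ε s ^ j)⁻¹ :=
  ((continuous_line ε).pow j).inv₀ fun s => pow_ne_zero _ (line_ne_zero hε s)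

theorem norm_line_inv_pow_le {ε s : ℝ} (hs : 1 ≤ |s|) {i j : ℕ} (hij : i ≤ j) :
    ‖(line ε s ^ j)⁻¹‖ ≤ (|s| ^ i)⁻¹ := by
  rw [norm_inv, norm_pow]
  refine inv_anti₀ (by positivity) ?_
  calc |s| ^ i ≤ |s| ^ j := pow_le_pow_right₀ hs hij
    _ ≤ _ := pow_le_pow_left₀ (abs_nonneg s) (abs_le_norm_line ε s) j

theorem integrable_line_inv_pow {ε : ℝ} (hε : 0 < ε) {j : ℕ} (hj : 2 ≤ j) :
    Integrable fun s : ℝ => (line ε s ^ j)⁻¹ :=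
  integrable_of_norm_le_div_sq (C := 1) (continuous_line_inv_pow hε j) fun s hs => by
    simpa using norm_line_inv_pow_le (ε := ε) hs hj

theorem tendsto_line_inv_pow {ε : ℝ} {j : ℕ} (hj : j ≠ 0) {l : Filter ℝ}
    (hl : Tendsto (fun s : ℝ => |s|) l atTop) :
    Tendsto (fun s : ℝ => (line ε s ^ j)⁻¹) l (𝓝 0) := by
  have h : Tendsto (fun s : ℝ => (|s| ^ j)⁻¹) l (𝓝 0) :=
    tendsto_inv_atTop_zero.comp ((tendsto_pow_atTop hj).comp hl)
  refine squeeze_zero_norm' ?_ h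
  filter_upwards [hl.eventually_ge_atTop 1] with s hs using norm_line_inv_pow_le hs le_rfl

theorem integral_line_inv_pow {ε : ℝ} (hε : 0 < ε) {j : ℕ} (hj : 2 ≤ j) :
    ∫ s : ℝ, (line ε s ^ j)⁻¹ = 0 := by
  obtain ⟨k, rfl⟩ := Nat.exists_eq_add_of_le' hj
  have hk : ((k : ℂ) + 1) ≠ 0 := by exact_mod_cast k.succ_ne_zero
  have hd (s : ℝ) : HasDerivAt (fun s : ℝ => -((k : ℂ) + 1)⁻¹ * (line ε s ^ (k + 1))⁻¹)
      ((line ε s ^ (k + 2))⁻¹) s := by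
    have h0 := line_ne_zero hε s
    refine ((((hasDerivAt_line ε s).pow (k + 1)).inv (pow_ne_zero _ h0)).const_mul
      (-((k : ℂ) + 1)⁻¹)).congr_deriv ?_
    simp only [Nat.cast_add, Nat.cast_one, Nat.add_sub_cancel, Pi.pow_apply]
    field_simp
    ring
  have ht {l : Filter ℝ} (hl : Tendsto (fun s : ℝ => |s|) l atTop) :
      Tendsto (fun s : ℝ => -((k : ℂ) + 1)⁻¹ * (line ε s ^ (k + 1))⁻¹) l (𝓝 0) := by
    simpa using (tendsto_line_inv_pow (ε := ε) k.succ_ne_zero hl).const_mul (-((k : ℂ) + 1)⁻¹)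
  simpa using integral_of_hasDerivAt_of_tendsto hd (integrable_line_inv_pow hε hj)
    (ht tendsto_abs_atBot_atTop) (ht tendsto_abs_atTop_atTop)

theorem tendsto_log_add_sub_log_atTop (b : ℂ) :
    Tendsto (fun s : ℝ => log (s + b) - Real.log |s|) atTop (𝓝 0) := by
  have h1 : Tendsto (fun s : ℝ => (1 : ℂ) + b * ((s⁻¹ : ℝ) : ℂ)) atTop (𝓝 (1 + b * ((0 : ℝ) : ℂ))) :=
    (((Complex.continuous_ofReal.tendsto 0).comp tendsto_inv_atTop_zero).const_mul b).const_add 1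
  simp only [ofReal_zero, mul_zero, add_zero] at h1
  have h2 := (continuousAt_clog one_mem_slitPlane).tendsto.comp h1
  rw [log_one] at h2
  refine h2.congr' ?_
  filter_upwards [eventually_gt_atTop 0, h1.eventually_ne one_ne_zero] with s hs hne
  have : (s : ℂ) + b = s * (1 + b * ((s⁻¹ : ℝ) : ℂ)) := by
    have : (s : ℂ) ≠ 0 := by exact_mod_cast hs.ne'
    push_cast; field_simp
  rw [this, log_ofReal_mul hs hne, abs_of_pos hs, Function.comp_apply]
  ring

theorem log_add_sub_log_of_neg {b : ℂ} (hb : b.im ≠ 0) {s : ℝ} (hs : s < 0) :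
    log (s + b) - Real.log |s| = log (-1 + b * (((-s)⁻¹ : ℝ) : ℂ)) := by
  have hne : -1 + b * (((-s)⁻¹ : ℝ) : ℂ) ≠ 0 := fun h => by
    have := congrArg Complex.im h
    rw [Complex.add_im, Complex.im_mul_ofReal] at this
    simp [hb, hs.ne] at this
  have : (s : ℂ) + b = ((-s : ℝ) : ℂ) * (-1 + b * (((-s)⁻¹ : ℝ) : ℂ)) := by
    have : (s : ℂ) ≠ 0 := by exact_mod_cast hs.ne
    push_cast; field_simp; ring
  rw [this, log_ofReal_mul (neg_pos.mpr hs) hne, abs_of_neg hs]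
  ring

theorem tendsto_neg_one_add_mul_inv (b : ℂ) :
    Tendsto (fun s : ℝ => -1 + b * (((-s)⁻¹ : ℝ) : ℂ)) atBot (𝓝 (-1)) := by
  have h1 : Tendsto (fun s : ℝ => (-1 : ℂ) + b * (((-s)⁻¹ : ℝ) : ℂ)) atBot
      (𝓝 (-1 + b * ((0 : ℝ) : ℂ))) :=
    (((Complex.continuous_ofReal.tendsto 0).comp
      (tendsto_inv_atTop_zero.comp tendsto_neg_atBot_atTop)).const_mul b).const_add (-1)
  simpa using h1

theorem tendsto_log_add_sub_log_atBot_of_im_pos {b : ℂ} (hb : 0 < b.im) :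
    Tendsto (fun s : ℝ => log (s + b) - Real.log |s|) atBot (𝓝 (Real.pi * I)) := by
  have h1 : Tendsto (fun s : ℝ => -1 + b * (((-s)⁻¹ : ℝ) : ℂ)) atBot (𝓝[{z | 0 ≤ z.im}] (-1)) := by
    refine tendsto_nhdsWithin_iff.mpr ⟨tendsto_neg_one_add_mul_inv b, ?_⟩
    filter_upwards [eventually_lt_atBot 0] with s hs
    rw [Complex.add_im, Complex.im_mul_ofReal]
    have : 0 < (-s)⁻¹ := inv_pos.mpr (neg_pos.mpr hs)
    simp only [neg_im, one_im, neg_zero, zero_add]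
    positivity
  have h2 := (tendsto_log_nhdsWithin_im_nonneg_of_re_neg_of_im_zero (z := -1) (by simp)
    (by simp)).comp h1
  simp only [norm_neg, norm_one, Real.log_one, ofReal_zero, zero_add] at h2
  refine h2.congr' ?_
  filter_upwards [eventually_lt_atBot 0] with s hs using (log_add_sub_log_of_neg hb.ne' hs).symm

theorem tendsto_log_add_sub_log_atBot_of_im_neg {b : ℂ} (hb : b.im < 0) :
    Tendsto (fun s : ℝ => log (s + b) - Real.log |s|) atBot (𝓝 (-(Real.pi * I))) := by
  have h1 : Tendsto (fun s : ℝ => -1 + b * (((-s)⁻¹ : ℝ) : ℂ)) atBot (𝓝[{z | z.im < 0}] (-1)) := by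
    refine tendsto_nhdsWithin_iff.mpr ⟨tendsto_neg_one_add_mul_inv b, ?_⟩
    filter_upwards [eventually_lt_atBot 0] with s hs
    rw [Complex.add_im, Complex.im_mul_ofReal]
    have : 0 < (-s)⁻¹ := inv_pos.mpr (neg_pos.mpr hs)
    simp only [neg_im, one_im, neg_zero, zero_add]
    exact mul_neg_of_neg_of_pos hb this
  have h2 := (tendsto_log_nhdsWithin_im_neg_of_re_neg_of_im_zero (z := -1) (by simp)
    (by simp)).comp h1
  simp only [norm_neg, norm_one, Real.log_one, ofReal_zero, zero_sub] at h2
  refine h2.congr' ?_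
  filter_upwards [eventually_lt_atBot 0] with s hs using (log_add_sub_log_of_neg hb.ne hs).symm

/-- The normalized value of `∫ dλ / (λ (λ - μ))` over the line of imaginary part `ε`. -/
noncomputable def above (ε : ℝ) (μ : ℂ) : ℂ := if ε < μ.im then 1 else 0

theorem abs_sub_le_norm_line_sub (ε s : ℝ) (μ : ℂ) : |μ.im - ε| ≤ ‖line ε s - μ‖ := by
  rw [abs_sub_comm]
  simpa using Complex.abs_im_le_norm (line ε s - μ)

theorem line_sub_ne_zero {ε : ℝ} {μ : ℂ} (hμ : μ.im ≠ ε) (s : ℝ) : line ε s - μ ≠ 0 :=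
  norm_pos_iff.mp ((abs_pos.mpr (sub_ne_zero.mpr hμ)).trans_le (abs_sub_le_norm_line_sub ε s μ))

theorem continuous_line_sub_inv {ε : ℝ} {μ : ℂ} (hμ : μ.im ≠ ε) :
    Continuous fun s : ℝ => (line ε s - μ)⁻¹ :=
  ((continuous_line ε).sub continuous_const).inv₀ (line_sub_ne_zero hμ)

theorem norm_line_sub_inv_le {ε : ℝ} {μ : ℂ} (hμ : μ.im ≠ ε) (s : ℝ) :
    ‖(line ε s - μ)⁻¹‖ ≤ |μ.im - ε|⁻¹ := by
  rw [norm_inv]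
  exact inv_anti₀ (abs_pos.mpr (sub_ne_zero.mpr hμ)) (abs_sub_le_norm_line_sub ε s μ)

theorem line_sub_inv_isBigO {ε : ℝ} {μ : ℂ} (hμ : μ.im ≠ ε) :
    ∃ C : ℝ, ∀ s : ℝ, 1 ≤ |s| → ‖(line ε s - μ)⁻¹‖ ≤ C * |s|⁻¹ := by
  refine ⟨1 + ‖μ‖ * |μ.im - ε|⁻¹, fun s hs => ?_⟩
  have h0 := line_sub_ne_zero hμ s
  have hs0 : 0 < |s| := by linarith
  rw [← div_eq_mul_inv, le_div_iff₀ hs0]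
  calc ‖(line ε s - μ)⁻¹‖ * |s| ≤ ‖(line ε s - μ)⁻¹‖ * (‖line ε s - μ‖ + ‖μ‖) := by
        gcongr
        refine (abs_le_norm_line ε s).trans ?_
        simpa using norm_add_le (line ε s - μ) μ
    _ = 1 + ‖μ‖ * ‖(line ε s - μ)⁻¹‖ := by
        rw [mul_add, norm_inv, inv_mul_cancel₀ (norm_ne_zero_iff.mpr h0), mul_comm ‖μ‖]
    _ ≤ _ := by gcongr; exact norm_line_sub_inv_le hμ s

theorem integrable_line_inv_pow_mul_sub_inv {ε : ℝ} (hε : 0 < ε) {μ : ℂ} (hμ : μ.im ≠ ε)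
    {j : ℕ} (hj : 1 ≤ j) : Integrable fun s : ℝ => (line ε s ^ j)⁻¹ * (line ε s - μ)⁻¹ := by
  obtain ⟨C, hC⟩ := line_sub_inv_isBigO hμ
  refine integrable_of_norm_le_div_sq (C := C)
    ((continuous_line_inv_pow hε j).mul (continuous_line_sub_inv hμ)) fun s hs => ?_
  rw [norm_mul]
  calc _ ≤ (|s| ^ 1)⁻¹ * (C * |s|⁻¹) := mul_le_mul (norm_line_inv_pow_le hs hj) (hC s hs)
        (norm_nonneg _) (by positivity)
    _ = C / s ^ 2 := by rw [← sq_abs s, pow_one, pow_two, div_eq_mul_inv, mul_inv]; ring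

theorem integral_line_inv_mul_sub_inv {ε : ℝ} (hε : 0 < ε) {μ : ℂ} (hμ : μ.im ≠ ε)
    (hμ0 : μ ≠ 0) : ∫ s : ℝ, (line ε s)⁻¹ * (line ε s - μ)⁻¹ =
      2 * Real.pi * I * above ε μ * μ⁻¹ := by
  have hd (s : ℝ) : HasDerivAt (fun s : ℝ => μ⁻¹ * (log (line ε s - μ) - log (line ε s)))
      ((line ε s)⁻¹ * (line ε s - μ)⁻¹) s := by
    have h0 := line_ne_zero hε s
    have h1 := line_sub_ne_zero hμ s
    refine (((((hasDerivAt_line ε s).sub_const μ).clog_real ?_).sub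
      ((hasDerivAt_line ε s).clog_real ?_)).const_mul μ⁻¹).congr_deriv ?_
    · exact mem_slitPlane_iff.mpr (Or.inr <| by simpa [sub_eq_zero] using hμ.symm)
    · exact mem_slitPlane_iff.mpr (Or.inr <| by simpa using hε.ne')
    · field_simp; ring
  have key {l : Filter ℝ} {a b : ℂ}
      (ha : Tendsto (fun s : ℝ => log (s + (ε * I - μ)) - Real.log |s|) l (𝓝 a))
      (hb : Tendsto (fun s : ℝ => log (s + ε * I) - Real.log |s|) l (𝓝 b)) :
      Tendsto (fun s : ℝ => μ⁻¹ * (log (line ε s - μ) - log (line ε s))) l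
        (𝓝 (μ⁻¹ * (a - b))) := by
    refine ((ha.sub hb).const_mul μ⁻¹).congr fun s => ?_
    rw [line, ← add_sub_assoc]; ring
  have hint : Integrable fun s : ℝ => (line ε s)⁻¹ * (line ε s - μ)⁻¹ := by
    simpa using integrable_line_inv_pow_mul_sub_inv hε hμ le_rfl
  have htop := key (tendsto_log_add_sub_log_atTop _) (tendsto_log_add_sub_log_atTop _)
  have hline := tendsto_log_add_sub_log_atBot_of_im_pos (b := ε * I) (by simpa using hε)
  rcases hμ.lt_or_gt with h | h
  · have hbot := key (tendsto_log_add_sub_log_atBot_of_im_pos (by simpa using h)) hline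
    rw [integral_of_hasDerivAt_of_tendsto hd hint hbot htop, above, if_neg h.not_gt]
    ring
  · have hbot := key (tendsto_log_add_sub_log_atBot_of_im_neg (by simpa using h)) hline
    rw [integral_of_hasDerivAt_of_tendsto hd hint hbot htop, above, if_pos h]
    ring

theorem integral_line_inv_pow_mul_sub_inv {ε : ℝ} (hε : 0 < ε) {μ : ℂ} (hμ : μ.im ≠ ε)
    (hμ0 : μ ≠ 0) {j : ℕ} (hj : 1 ≤ j) :
    ∫ s : ℝ, (line ε s ^ j)⁻¹ * (line ε s - μ)⁻¹ =
      2 * Real.pi * I * above ε μ * (μ ^ j)⁻¹ := by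
  induction j, hj using Nat.le_induction with
  | base => simpa using integral_line_inv_mul_sub_inv hε hμ hμ0
  | succ j hj ih =>
    have h (s : ℝ) : (line ε s ^ (j + 1))⁻¹ * (line ε s - μ)⁻¹ =
        μ⁻¹ * ((line ε s ^ j)⁻¹ * (line ε s - μ)⁻¹ - (line ε s ^ (j + 1))⁻¹) := by
      have h0 := line_ne_zero hε s
      have h1 := line_sub_ne_zero hμ s
      field_simp
      ring
    simp_rw [h]
    rw [integral_const_mul, integral_sub (integrable_line_inv_pow_mul_sub_inv hε hμ hj)
      (integrable_line_inv_pow hε (by omega)), ih, integral_line_inv_pow hε (by omega)]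
    field_simp
    ring

theorem integral_line_eq_of_differentiableOn {F : Type*} [NormedAddCommGroup F] [NormedSpace ℂ F]
    [CompleteSpace F] {f : ℂ → F} {ε₁ ε₂ : ℝ} (hε : ε₁ ≤ ε₂)
    (hf : DifferentiableOn ℂ f {z | z.im ∈ Set.Icc ε₁ ε₂}) {C : ℝ}
    (hC : ∀ z : ℂ, z.im ∈ Set.Icc ε₁ ε₂ → 1 ≤ |z.re| → ‖f z‖ ≤ C / z.re ^ 2) :
    ∫ s : ℝ, f (line ε₁ s) = ∫ s : ℝ, f (line ε₂ s) := by
  have hint {ε : ℝ} (h : ε ∈ Set.Icc ε₁ ε₂) : Integrable fun s : ℝ => f (line ε s) := by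
    refine integrable_of_norm_le_div_sq (C := C) ?_ fun s hs => ?_
    · exact hf.continuousOn.comp_continuous (continuous_line ε) fun s => by simpa using h
    · simpa using hC (line ε s) (by simpa using h) (by simpa using hs)
  have hlim {ε : ℝ} (h : ε ∈ Set.Icc ε₁ ε₂) :
      Tendsto (fun T : ℝ => ∫ s in (-T)..T, f (line ε s)) atTop (𝓝 (∫ s : ℝ, f (line ε s))) :=
    intervalIntegral_tendsto_integral (hint h) tendsto_neg_atTop_atBot tendsto_id
  have hvert {σ : ℝ → ℝ} (hσ : ∀ T, |σ T| = |T|) :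
      Tendsto (fun T : ℝ => I • ∫ y in ε₁..ε₂, f (σ T + y * I)) atTop (𝓝 0) := by
    have h0 : Tendsto (fun T : ℝ => C / T ^ 2 * |ε₂ - ε₁|) atTop (𝓝 0) := by
      simpa using (tendsto_const_nhds.div_atTop (tendsto_pow_atTop two_ne_zero)).mul_const
        |ε₂ - ε₁|
    refine squeeze_zero_norm' ?_ h0
    filter_upwards [eventually_ge_atTop 1] with T hT
    rw [norm_smul, norm_I, one_mul]
    refine intervalIntegral.norm_integral_le_of_norm_le_const fun y hy => ?_
    rw [Set.uIoc_of_le hε] at hy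
    have := hC (σ T + y * I) (by simpa using ⟨hy.1.le, hy.2⟩)
      (by simpa [hσ, abs_of_pos (zero_lt_one.trans_le hT)] using hT)
    rwa [add_re, ofReal_re, re_ofReal_mul, I_re, mul_zero, add_zero, ← sq_abs (σ T), hσ,
      sq_abs] at this
  have hrect (T : ℝ) : (∫ s in (-T)..T, f (line ε₁ s)) - (∫ s in (-T)..T, f (line ε₂ s)) =
      (I • ∫ y in ε₁..ε₂, f ((-T : ℝ) + y * I)) - I • ∫ y in ε₁..ε₂, f (T + y * I) := by
    have := integral_boundary_rect_eq_zero_of_differentiableOn f (line ε₁ (-T)) (line ε₂ T)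
      (hf.mono fun z hz => by
        have := hz.2
        simp only [line_im, Set.uIcc_of_le hε] at this
        exact this)
    simp only [line_re, line_im] at this
    rw [← sub_eq_zero, ← this]
    unfold line
    abel
  have h1 := (hlim (Set.left_mem_Icc.mpr hε)).sub (hlim (Set.right_mem_Icc.mpr hε))
  have h2 := (hvert (σ := fun T => -T) fun T => abs_neg T).sub (hvert (σ := id) fun T => rfl)
  rw [sub_zero] at h2
  exact sub_eq_zero.mp (tendsto_nhds_unique h1 (h2.congr fun T => (hrect T).symm))

section PseudoResolvent

variable {𝓐 : Type*} [NormedRing 𝓐] [NormedAlgebra ℂ 𝓐]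

/-- The functional calculus `(2πi)⁻¹ ∫ λ⁻ʲ R(λ) dλ` over the line of imaginary part `ε`. -/
noncomputable def lineOp (R : ℂ → 𝓐) (ε : ℝ) (j : ℕ) : 𝓐 :=
  (2 * Real.pi * I)⁻¹ • ∫ s : ℝ, (line ε s ^ j)⁻¹ • R (line ε s)

/-- The first resolvent identity on `U`. -/
def IsResolventOn (R : ℂ → 𝓐) (U : Set ℂ) : Prop :=
  ∀ z ∈ U, ∀ w ∈ U, R z - R w = (w - z) • (R z * R w)

variable {R : ℂ → 𝓐} {U : Set ℂ}

theorem IsResolventOn.mul_eq (hR : IsResolventOn R U) {z w : ℂ} (hz : z ∈ U) (hw : w ∈ U)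
    (h : z ≠ w) : R z * R w = (z - w)⁻¹ • R w - (z - w)⁻¹ • R z := by
  rw [← smul_sub, ← neg_sub (R z), hR z hz w hw, ← neg_smul, neg_sub,
    inv_smul_smul₀ (sub_ne_zero.mpr h)]

theorem IsResolventOn.commute (hR : IsResolventOn R U) {z w : ℂ} (hz : z ∈ U) (hw : w ∈ U) :
    Commute (R z) (R w) := by
  rcases eq_or_ne z w with rfl | h
  · exact Commute.refl _
  · have h1 := hR.mul_eq hz hw h
    have h2 := hR.mul_eq hw hz h.symm
    rw [← neg_sub z w, inv_neg, neg_smul, neg_smul, sub_neg_eq_add, neg_add_eq_sub] at h2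
    exact h1.trans h2.symm

theorem IsResolventOn.mul_neg_zero (hR : IsResolventOn R U) {z : ℂ} (hz : z ∈ U)
    (h0 : (0 : ℂ) ∈ U) (hz0 : z ≠ 0) : R z * -R 0 = z⁻¹ • R z + z⁻¹ • -R 0 := by
  rw [mul_neg, hR.mul_eq hz h0 hz0, sub_zero, smul_neg]
  abel

theorem commute_neg_zero_lineOp (hR : IsResolventOn R U) {ε : ℝ} {j : ℕ}
    (h0 : (0 : ℂ) ∈ U) (hline : ∀ s, line ε s ∈ U)
    (hint : Integrable fun s : ℝ => (line ε s ^ j)⁻¹ • R (line ε s)) :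
    Commute (-R 0) (lineOp R ε j) := by
  refine Commute.smul_right ?_ _
  rw [commute_iff_eq, ← integral_mul_const_of_integrable hint,
    ← integral_const_mul_of_integrable hint]
  congr 1 with s
  exact (((hR.commute h0 (hline s)).neg_left).smul_right _).eq

/-- The contour integral `(2πi)⁻¹ ∮ λ⁻ʲ R(λ) dλ` over the circle of centre `c` and radius `ρ`. -/
noncomputable def circleOp (R : ℂ → 𝓐) (c : ℂ) (ρ : ℝ) (j : ℕ) : 𝓐 :=
  (2 * Real.pi * I)⁻¹ • ∮ z in C(c, ρ), (z ^ j)⁻¹ • R z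

theorem commute_neg_zero_circleOp (hR : IsResolventOn R U) {c : ℂ} {ρ : ℝ} (hρ : 0 < ρ)
    (h0 : (0 : ℂ) ∈ U) (hU : sphere c ρ ⊆ U) (hRc : ContinuousOn R U) :
    Commute (-R 0) (circleOp R c ρ 0) := by
  refine Commute.smul_right ?_ _
  have := ((hRc.mono hU).circleIntegrable hρ.le).out
  rw [intervalIntegrable_iff_integrableOn_Ioc_of_le Real.two_pi_pos.le] at this
  simp only [pow_zero, inv_one, one_smul]
  rw [commute_iff_eq, circleIntegral, intervalIntegral.integral_of_le Real.two_pi_pos.le,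
    ← integral_mul_const_of_integrable this, ← integral_const_mul_of_integrable this]
  congr 1 with θ
  exact ((hR.commute h0 (hU (circleMap_mem_sphere c hρ.le θ))).neg_left.smul_right _).eq

variable [CompleteSpace 𝓐]

theorem lineOp_mul_of_im_ne (hR : IsResolventOn R U) {ε : ℝ} (hε : 0 < ε) {j : ℕ}
    (hj : 1 ≤ j) (hline : ∀ s, line ε s ∈ U)
    (hint : Integrable fun s : ℝ => (line ε s ^ j)⁻¹ • R (line ε s))
    {μ : ℂ} (hμ : μ ∈ U) (hμε : μ.im ≠ ε) (hμ0 : μ ≠ 0) :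
    lineOp R ε j * R μ = above ε μ • (μ ^ j)⁻¹ • R μ -
      (2 * Real.pi * I)⁻¹ • ∫ s : ℝ, (line ε s - μ)⁻¹ • (line ε s ^ j)⁻¹ • R (line ε s) := by
  have hpt (s : ℝ) : (line ε s ^ j)⁻¹ • R (line ε s) * R μ =
      ((line ε s ^ j)⁻¹ * (line ε s - μ)⁻¹) • R μ -
        (line ε s - μ)⁻¹ • (line ε s ^ j)⁻¹ • R (line ε s) := by
    rw [smul_mul_assoc, hR.mul_eq (hline s) hμ (sub_ne_zero.mp (line_sub_ne_zero hμε s)),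
      smul_sub, smul_smul, smul_comm]
  have hint2 : Integrable fun s : ℝ => (line ε s - μ)⁻¹ • (line ε s ^ j)⁻¹ • R (line ε s) :=
    hint.bdd_smul _ (continuous_line_sub_inv hμε).aestronglyMeasurable
      (Eventually.of_forall (norm_line_sub_inv_le hμε))
  rw [lineOp, smul_mul_assoc, ← integral_mul_const_of_integrable hint]
  simp_rw [hpt]
  rw [integral_sub ((integrable_line_inv_pow_mul_sub_inv hε hμε hj).smul_const _) hint2,
    integral_smul_const, integral_line_inv_pow_mul_sub_inv hε hμε hμ0 hj, smul_sub, smul_smul,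
    smul_smul, mul_assoc (2 * Real.pi * I), inv_mul_cancel_left₀ two_pi_I_ne_zero]

theorem lineOp_mul_integral {T : Type*} [MeasurableSpace T] {ν : Measure T} [SFinite ν]
    (hR : IsResolventOn R U) {ε : ℝ} (hε : 0 < ε) {j : ℕ} (hj : 1 ≤ j)
    (hline : ∀ s, line ε s ∈ U)
    (hint : Integrable fun s : ℝ => (line ε s ^ j)⁻¹ • R (line ε s))
    {c μ : T → ℂ} (hμ : Measurable μ) (hμU : ∀ t, μ t ∈ U) {δ : ℝ} (hδ : 0 < δ)
    (hsep : ∀ t, δ ≤ |(μ t).im - ε|) (hμ0 : ∀ t, μ t ≠ 0) {χ : ℂ}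
    (hχ : ∀ t, above ε (μ t) = χ) (hc : Integrable c ν)
    (hcR : Integrable (fun t => c t • R (μ t)) ν)
    (hker : ∀ s, ∫ t, (line ε s - μ t)⁻¹ * c t ∂ν = 0) :
    lineOp R ε j * ∫ t, c t • R (μ t) ∂ν = χ • ∫ t, (μ t ^ j)⁻¹ • c t • R (μ t) ∂ν := by
  have hμε (t : T) : (μ t).im ≠ ε := sub_ne_zero.mp (abs_pos.mp (hδ.trans_le (hsep t)))
  have hG : Integrable (fun p : T × ℝ =>
      (line ε p.2 - μ p.1)⁻¹ • c p.1 • (line ε p.2 ^ j)⁻¹ • R (line ε p.2)) (ν.prod volume) := by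
    refine (hc.smul_prod hint).bdd_smul δ⁻¹ (φ := fun p : T × ℝ => (line ε p.2 - μ p.1)⁻¹)
      ?_ (Eventually.of_forall fun p => ?_)
    · exact ((((continuous_line ε).measurable.comp measurable_snd).sub
        (hμ.comp measurable_fst)).inv).aestronglyMeasurable
    · exact (norm_line_sub_inv_le (hμε p.1) p.2).trans (inv_anti₀ hδ (hsep p.1))
  have hswap := integral_integral_swap
    (f := fun t s => (line ε s - μ t)⁻¹ • c t • (line ε s ^ j)⁻¹ • R (line ε s)) hG
  have hzero : ∫ t, (∫ s : ℝ, (line ε s - μ t)⁻¹ • c t • (line ε s ^ j)⁻¹ • R (line ε s)) ∂ν =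
      0 := by
    rw [hswap]
    simp_rw [smul_smul ((line ε _ - μ _)⁻¹) (c _)]
    simp_rw [integral_smul_const, hker, zero_smul, integral_zero]
  have hpt (t : T) : χ • (μ t ^ j)⁻¹ • c t • R (μ t) = lineOp R ε j * (c t • R (μ t)) +
      (2 * Real.pi * I)⁻¹ •
        ∫ s : ℝ, (line ε s - μ t)⁻¹ • c t • (line ε s ^ j)⁻¹ • R (line ε s) := by
    simp_rw [smul_comm _ (c t)]
    rw [mul_smul_comm, lineOp_mul_of_im_ne hR hε hj hline hint (hμU t) (hμε t) (hμ0 t), hχ,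
      integral_smul, smul_comm _ (c t), smul_sub, sub_add_cancel]
  have hB : Integrable (fun t =>
      ∫ s : ℝ, (line ε s - μ t)⁻¹ • c t • (line ε s ^ j)⁻¹ • R (line ε s)) ν :=
    hG.integral_prod_left
  rw [← integral_smul]
  simp_rw [hpt]
  rw [integral_add (hcR.const_mul _) (hB.fun_smul _), integral_smul, hzero,
    smul_zero, add_zero, integral_const_mul_of_integrable hcR]

theorem lineOp_mul_neg_zero (hR : IsResolventOn R U) {ε : ℝ} (hε : 0 < ε) {j : ℕ} (hj : 1 ≤ j)
    (h0 : (0 : ℂ) ∈ U) (hline : ∀ s, line ε s ∈ U)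
    (hint : Integrable fun s : ℝ => (line ε s ^ j)⁻¹ • R (line ε s))
    (hint' : Integrable fun s : ℝ => (line ε s ^ (j + 1))⁻¹ • R (line ε s)) :
    lineOp R ε j * -R 0 = lineOp R ε (j + 1) := by
  have hpt (s : ℝ) : (line ε s ^ j)⁻¹ • R (line ε s) * -R 0 =
      (line ε s ^ (j + 1))⁻¹ • R (line ε s) + (line ε s ^ (j + 1))⁻¹ • -R 0 := by
    rw [smul_mul_assoc, hR.mul_neg_zero (hline s) h0 (line_ne_zero hε s), smul_add, smul_smul,
      smul_smul, pow_succ, mul_inv]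
  rw [lineOp, smul_mul_assoc, ← integral_mul_const_of_integrable hint]
  simp_rw [hpt]
  rw [integral_add hint' ((integrable_line_inv_pow hε (by omega)).smul_const _),
    integral_smul_const, integral_line_inv_pow hε (by omega), zero_smul, add_zero, lineOp]

theorem lineOp_mul_neg_zero_pow (hR : IsResolventOn R U) {ε : ℝ} (hε : 0 < ε) {j : ℕ}
    (hj : 1 ≤ j) (h0 : (0 : ℂ) ∈ U) (hline : ∀ s, line ε s ∈ U)
    (hint : ∀ i, j ≤ i → Integrable fun s : ℝ => (line ε s ^ i)⁻¹ • R (line ε s)) (i : ℕ) :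
    lineOp R ε j * (-R 0) ^ i = lineOp R ε (j + i) := by
  induction i with
  | zero => simp
  | succ i ih =>
    rw [pow_succ, ← mul_assoc, ih, lineOp_mul_neg_zero hR hε (by omega) h0 hline
      (hint _ (by omega)) (hint _ (by omega)), add_assoc]

theorem lineOp_mul_lineOp (hR : IsResolventOn R U) {ε₁ ε₂ : ℝ} (hε₁ : 0 < ε₁) (hε : ε₁ < ε₂)
    {i j : ℕ} (hi : 1 ≤ i) (hj : 2 ≤ j) (hline₁ : ∀ s, line ε₁ s ∈ U)
    (hline₂ : ∀ s, line ε₂ s ∈ U)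
    (hint₁ : Integrable fun s : ℝ => (line ε₁ s ^ i)⁻¹ • R (line ε₁ s))
    (hint₂ : Integrable fun s : ℝ => (line ε₂ s ^ j)⁻¹ • R (line ε₂ s)) :
    lineOp R ε₁ i * lineOp R ε₂ j = lineOp R ε₂ (i + j) := by
  have hε₂ := hε₁.trans hε
  have hker (s : ℝ) : ∫ t : ℝ, (line ε₁ s - line ε₂ t)⁻¹ * (line ε₂ t ^ j)⁻¹ = 0 := by
    have h := integral_line_inv_pow_mul_sub_inv hε₂ (μ := line ε₁ s) (by simpa using hε.ne)
      (line_ne_zero hε₁ s) (j := j) (by omega)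
    simp only [above, line_im, hε.not_gt, if_false, mul_zero, zero_mul] at h
    rw [← neg_eq_zero, ← integral_neg, ← h]
    congr 1 with t
    rw [← neg_sub, inv_neg, neg_mul, neg_neg, mul_comm]
  have h := lineOp_mul_integral hR hε₁ hi hline₁ hint₁ (continuous_line ε₂).measurable hline₂
    (sub_pos.mpr hε) (fun t => by rw [line_im]; exact le_abs_self _) (line_ne_zero hε₂) (χ := 1)
    (fun t => by simp [above, hε]) (integrable_line_inv_pow hε₂ hj) hint₂ hker
  rw [lineOp.eq_def R ε₂, mul_smul_comm, h, one_smul, lineOp]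
  simp_rw [smul_smul, ← mul_inv, ← pow_add]

theorem circleOp_mul_neg_zero (hR : IsResolventOn R U) {c : ℂ} {ρ : ℝ} (hρ : 0 < ρ)
    (h0 : (0 : ℂ) ∈ U) (hc : ρ < ‖c‖) (hU : sphere c ρ ⊆ U) (hRc : ContinuousOn R U) (j : ℕ) :
    circleOp R c ρ j * -R 0 = circleOp R c ρ (j + 1) := by
  have hne {z : ℂ} (hz : z ∈ closedBall c ρ) : z ≠ 0 := by
    rintro rfl
    rw [mem_closedBall, dist_zero_left] at hz
    linarith
  have hcont (i : ℕ) : ContinuousOn (fun z : ℂ => (z ^ i)⁻¹) (closedBall c ρ) :=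
    (continuousOn_pow i).inv₀ fun z hz => pow_ne_zero _ (hne hz)
  have hint (i : ℕ) : CircleIntegrable (fun z : ℂ => (z ^ i)⁻¹ • R z) c ρ :=
    (((hcont i).mono sphere_subset_closedBall).smul (hRc.mono hU)).circleIntegrable hρ.le
  have hpt {z : ℂ} (hz : z ∈ sphere c ρ) : (z ^ j)⁻¹ • R z * -R 0 =
      (z ^ (j + 1))⁻¹ • R z + (z ^ (j + 1))⁻¹ • -R 0 := by
    rw [smul_mul_assoc, hR.mul_neg_zero (hU hz) h0 (hne (sphere_subset_closedBall hz)), smul_add,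
      smul_smul, smul_smul, pow_succ, mul_inv]
  have hmul : (∮ z in C(c, ρ), (z ^ j)⁻¹ • R z) * -R 0 =
      ∮ z in C(c, ρ), (z ^ j)⁻¹ • R z * -R 0 := by
    have := (hint j).out
    rw [intervalIntegrable_iff_integrableOn_Ioc_of_le Real.two_pi_pos.le] at this
    rw [circleIntegral, circleIntegral, intervalIntegral.integral_of_le Real.two_pi_pos.le,
      intervalIntegral.integral_of_le Real.two_pi_pos.le, ← integral_mul_const_of_integrable this]
    simp_rw [smul_mul_assoc]
  have hzero : ∮ z in C(c, ρ), (z ^ (j + 1))⁻¹ • -R 0 = 0 := by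
    rw [circleIntegral.integral_smul_const,
      circleIntegral_eq_zero_of_differentiable_on_off_countable hρ.le Set.countable_empty
        (hcont _), zero_smul]
    intro z hz
    exact (differentiableAt_pow _).inv (pow_ne_zero _ (hne (ball_subset_closedBall hz.1)))
  rw [circleOp, smul_mul_assoc, hmul, circleIntegral.integral_congr hρ.le fun z hz => hpt hz,
    circleIntegral.integral_add (hint _) ?_, hzero, add_zero, circleOp]
  exact (((hcont _).mono sphere_subset_closedBall).smul continuousOn_const).circleIntegrable hρ.le

theorem circleOp_mul_neg_zero_pow (hR : IsResolventOn R U) {c : ℂ} {ρ : ℝ} (hρ : 0 < ρ)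
    (h0 : (0 : ℂ) ∈ U) (hc : ρ < ‖c‖) (hU : sphere c ρ ⊆ U) (hRc : ContinuousOn R U) (j : ℕ) :
    circleOp R c ρ 0 * (-R 0) ^ j = circleOp R c ρ j := by
  induction j with
  | zero => simp
  | succ j ih => rw [pow_succ, ← mul_assoc, ih, circleOp_mul_neg_zero hR hρ h0 hc hU hRc]

theorem lineOp_mul_circleOp (hR : IsResolventOn R U) {ε : ℝ} (hε : 0 < ε) {j : ℕ} (hj : 1 ≤ j)
    (hline : ∀ s, line ε s ∈ U)
    (hint : Integrable fun s : ℝ => (line ε s ^ j)⁻¹ • R (line ε s))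
    {c : ℂ} {ρ : ℝ} (hρ : 0 < ρ) (hc : ρ < ‖c‖) (hcε : ρ < |c.im - ε|)
    (hU : sphere c ρ ⊆ U) (hRc : ContinuousOn R U) :
    lineOp R ε j * circleOp R c ρ 0 = above ε c • circleOp R c ρ j := by
  have him {z : ℂ} (hz : z ∈ closedBall c ρ) : |z.im - c.im| ≤ ρ := by
    rw [mem_closedBall, dist_eq] at hz
    exact (by simpa using abs_im_le_norm (z - c) : |z.im - c.im| ≤ ‖z - c‖).trans hz
  have hne {z : ℂ} (hz : z ∈ closedBall c ρ) : z ≠ 0 := by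
    rintro rfl
    rw [mem_closedBall, dist_zero_left] at hz
    linarith
  have hmem (θ : ℝ) : circleMap c ρ θ ∈ sphere c ρ := circleMap_mem_sphere c hρ.le θ
  have hsep {z : ℂ} (hz : z ∈ closedBall c ρ) : |c.im - ε| - ρ ≤ |z.im - ε| := by
    have h1 := him hz
    have h2 := abs_sub_le c.im z.im ε
    rw [abs_sub_comm c.im z.im] at h2
    linarith
  have hχ (θ : ℝ) : above ε (circleMap c ρ θ) = above ε c := by
    have h1 := abs_le.mp (him (sphere_subset_closedBall (hmem θ)))
    unfold above
    rcases lt_abs.mp hcε with h | h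
    · rw [if_pos (by linarith), if_pos (by linarith)]
    · rw [if_neg (by linarith), if_neg (by linarith)]
  have hint2 := ((hRc.mono hU).circleIntegrable hρ.le).out
  rw [intervalIntegrable_iff_integrableOn_Ioc_of_le Real.two_pi_pos.le] at hint2
  have hker (s : ℝ) : ∫ θ in Set.Ioc 0 (2 * Real.pi), (line ε s - circleMap c ρ θ)⁻¹ *
      deriv (circleMap c ρ) θ = 0 := by
    have hd {z : ℂ} (hz : z ∈ closedBall c ρ) : line ε s - z ≠ 0 :=
      line_sub_ne_zero (sub_ne_zero.mp (abs_pos.mp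
        ((sub_pos.mpr hcε).trans_le (hsep hz)))) s
    have h : ∮ z in C(c, ρ), (line ε s - z)⁻¹ = 0 :=
      circleIntegral_eq_zero_of_differentiable_on_off_countable hρ.le Set.countable_empty
        ((continuousOn_const.sub continuousOn_id).inv₀ fun z hz => hd hz)
        fun z hz => ((differentiableAt_const _).sub differentiableAt_id).inv
          (hd (ball_subset_closedBall hz.1))
    rw [circleIntegral, intervalIntegral.integral_of_le Real.two_pi_pos.le] at h
    simpa only [smul_eq_mul, mul_comm] using h
  have h := lineOp_mul_integral hR hε hj hline hint
    (ν := volume.restrict (Set.Ioc 0 (2 * Real.pi))) (continuous_circleMap c ρ).measurable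
    (fun θ => hU (hmem θ)) (sub_pos.mpr hcε)
    (fun θ => hsep (sphere_subset_closedBall (hmem θ)))
    (fun θ => hne (sphere_subset_closedBall (hmem θ))) hχ
    (c := deriv (circleMap c ρ)) ?_ hint2 hker
  · rw [circleOp, circleOp, circleIntegral, circleIntegral,
      intervalIntegral.integral_of_le Real.two_pi_pos.le,
      intervalIntegral.integral_of_le Real.two_pi_pos.le]
    simp only [pow_zero, inv_one, one_smul]
    rw [mul_smul_comm, h, smul_comm]
    simp_rw [smul_comm (deriv _ _)]
  · have : Continuous (deriv (circleMap c ρ)) := by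
      simp_rw [funext (deriv_circleMap c ρ)]
      fun_prop
    exact (this.integrableOn_Icc).mono_set Set.Ioc_subset_Icc_self

end PseudoResolvent

theorem ResolventAt.sub_eq {A : G →ₗ.[ℂ] G} {z w : ℂ} {R S : G →L[ℂ] G}
    (hR : ResolventAt A z R) (hS : ResolventAt A w S) : R - S = (w - z) • (R * S) := by
  ext y
  have h1 := hR.leftInv ⟨S y, hS.mem y⟩
  have h2 : z • S y - A ⟨S y, hS.mem y⟩ = y - (w - z) • S y := by
    rw [eq_sub_iff_add_eq, sub_smul]
    conv_rhs => rw [← hS.solves y]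
    abel
  rw [h2, map_sub, map_smul] at h1
  change R y - S y = (w - z) • R (S y)
  rw [sub_eq_iff_eq_add, add_comm, ← sub_eq_iff_eq_add]
  exact h1

theorem ResolventAt.unique {A : G →ₗ.[ℂ] G} {z : ℂ} {R S : G →L[ℂ] G}
    (hR : ResolventAt A z R) (hS : ResolventAt A z S) : R = S := by
  simpa [sub_eq_zero] using hR.sub_eq hS

theorem ResolventAt.mul_inverse {A : G →ₗ.[ℂ] G} {z w : ℂ} {R : G →L[ℂ] G}
    (hR : ResolventAt A z R) (h : IsUnit (1 + (w - z) • R)) :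
    ResolventAt A w (R * Ring.inverse (1 + (w - z) • R)) := by
  set T := 1 + (w - z) • R with hT
  have hcomm : Commute R (Ring.inverse T) := by
    have : Commute R T := (Commute.one_right R).add_right ((Commute.refl R).smul_right _)
    obtain ⟨u, hu⟩ := h
    rw [← hu, Ring.inverse_unit]
    rw [← hu] at this
    exact this.units_inv_right
  refine ⟨fun y => hR.mem _, fun y => ?_, fun x => ?_⟩
  · have h1 := hR.solves (Ring.inverse T y)
    have h2 : T (Ring.inverse T y) = y := by
      simpa using DFunLike.congr_fun (Ring.mul_inverse_cancel T h) y
    have h3 : T (Ring.inverse T y) = Ring.inverse T y + (w - z) • R (Ring.inverse T y) := by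
      simp [hT]
    change w • R (Ring.inverse T y) - A ⟨R (Ring.inverse T y), _⟩ = y
    have h4 : w • R (Ring.inverse T y) - A ⟨R (Ring.inverse T y), hR.mem _⟩ =
        T (Ring.inverse T y) := by
      rw [h3, ← sub_eq_iff_eq_add]
      conv_rhs => rw [← h1]
      rw [sub_smul]
      abel
    exact h4.trans h2
  · have h1 : R (w • (x : G) - A x) = T x := by
      have h2 := hR.leftInv x
      have h3 : w • (x : G) - A x = (z • (x : G) - A x) + (w - z) • (x : G) := by
        rw [sub_smul]; abel
      rw [h3, map_add, h2, map_smul]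
      simp [hT]
    rw [hcomm.eq]
    change Ring.inverse T (R (w • (x : G) - A x)) = x
    rw [h1]
    simpa using DFunLike.congr_fun (Ring.inverse_mul_cancel T h) (x : G)

theorem ResolventAt.eq_zero_of_apply_eq_zero {A : G →ₗ.[ℂ] G} {z : ℂ} {R : G →L[ℂ] G}
    (hR : ResolventAt A z R) {y : G} (h : R y = 0) : y = 0 := by
  rw [← hR.solves y]
  have : (⟨R y, hR.mem y⟩ : A.domain) = 0 := Subtype.ext h
  rw [this, h]
  simp

theorem isOpen_resolventSet [CompleteSpace G] (A : G →ₗ.[ℂ] G) : IsOpen (resolventSet A) := by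
  refine isOpen_iff_mem_nhds.mpr fun z ⟨R, hR⟩ => ?_
  have hc : Continuous fun w : ℂ => (1 : G →L[ℂ] G) + (w - z) • R := by fun_prop
  have hz1 : IsUnit ((1 : G →L[ℂ] G) + (z - z) • R) := by simp
  filter_upwards [hc.continuousAt.eventually (Units.isOpen.mem_nhds hz1)] with w hw
  exact ⟨_, hR.mul_inverse hw⟩

theorem isResolventOn_resolventSet {A : G →ₗ.[ℂ] G} {Rres : ℂ → G →L[ℂ] G}
    (hres : ∀ z ∈ resolventSet A, ResolventAt A z (Rres z)) :
    IsResolventOn Rres (resolventSet A) :=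
  fun z hz w hw => (hres z hz).sub_eq (hres w hw)

theorem differentiableOn_resolvent [CompleteSpace G] {A : G →ₗ.[ℂ] G} {Rres : ℂ → G →L[ℂ] G}
    (hres : ∀ z ∈ resolventSet A, ResolventAt A z (Rres z)) :
    DifferentiableOn ℂ Rres (resolventSet A) := by
  intro z hz
  have hd : Differentiable ℂ fun w : ℂ => (1 : G →L[ℂ] G) + (w - z) • Rres z := by fun_prop
  have hz1 : IsUnit ((1 : G →L[ℂ] G) + (z - z) • Rres z) := by simp
  have hev : ∀ᶠ w in 𝓝 z, IsUnit ((1 : G →L[ℂ] G) + (w - z) • Rres z) :=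
    hd.continuous.continuousAt.eventually (Units.isOpen.mem_nhds hz1)
  have hD : DifferentiableAt ℂ
      (fun w => Rres z * Ring.inverse ((1 : G →L[ℂ] G) + (w - z) • Rres z)) z :=
    ((hd z).inverse hz1).const_mul _
  refine (hD.congr_of_eventuallyEq ?_).differentiableWithinAt
  filter_upwards [hev] with w hw
  have := (hres z hz).mul_inverse hw
  exact (hres w ⟨_, this⟩).unique this

theorem norm_laplace_integral_le {m : ℕ} {M : ℝ} (hM : 0 ≤ M) {S : ℝ → G →L[ℂ] G}
    (hS : ∀ t : ℝ, 0 ≤ t → ‖S t‖ ≤ M * (1 + t ^ m)) {z : ℂ} (hz : 1 ≤ z.re) (x : G) :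
    ‖∫ t in Set.Ioi (0 : ℝ), exp (-z * t) • S t x‖ ≤
      M * (1 + 2 ^ m * m.factorial) * 2 / z.re * ‖x‖ := by
  have hpow {t : ℝ} (ht : 0 ≤ t) : 1 + t ^ m ≤ (1 + 2 ^ m * m.factorial) * Real.exp (t / 2) := by
    have h1 := Real.pow_div_factorial_le_exp (t / 2) (by positivity) m
    rw [div_le_iff₀ (by positivity), div_pow, div_le_iff₀ (by positivity)] at h1
    have h2 : 1 ≤ Real.exp (t / 2) := Real.one_le_exp (by positivity)
    linarith
  have hint : IntegrableOn (fun t : ℝ => M * (1 + 2 ^ m * m.factorial) * ‖x‖ *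
      Real.exp (-(z.re / 2) * t)) (Set.Ioi 0) :=
    (exp_neg_integrableOn_Ioi 0 (by linarith)).const_mul _
  refine (norm_integral_le_of_norm_le hint ?_).trans_eq ?_
  · filter_upwards [ae_restrict_mem measurableSet_Ioi] with t ht
    have ht : 0 < t := ht
    rw [norm_smul, norm_exp, re_mul_ofReal, neg_re]
    calc Real.exp (-z.re * t) * ‖S t x‖
        ≤ Real.exp (-z.re * t) *
            (M * ((1 + 2 ^ m * m.factorial) * Real.exp (t / 2)) * ‖x‖) := by
          gcongr
          refine ((S t).le_opNorm x).trans ?_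
          gcongr
          exact (hS t ht.le).trans (by gcongr; exact hpow ht.le)
      _ = M * (1 + 2 ^ m * m.factorial) * ‖x‖ * Real.exp (-z.re * t + t / 2) := by
          rw [Real.exp_add]; ring
      _ ≤ _ := by gcongr; nlinarith
  · rw [integral_const_mul, integral_exp_mul_Ioi (by linarith)]
    simp
    field_simp

theorem Generates.exists_norm_resolvent_le {A : G →ₗ.[ℂ] G} {n m : ℕ} {M : ℝ} (hM : 0 ≤ M)
    {Sp Sm : ℝ → G →L[ℂ] G} (hgen : Generates A n m M Sp Sm) {Rres : ℂ → G →L[ℂ] G}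
    (hres : ∀ z ∈ resolventSet A, ResolventAt A z (Rres z)) :
    ∃ C : ℝ, 0 ≤ C ∧ ∀ z : ℂ, 1 ≤ |z.re| → ‖Rres z‖ ≤ ‖z‖ ^ n * (C / |z.re|) := by
  obtain ⟨-, -, hSp, hSm, hlap⟩ := hgen
  refine ⟨M * (1 + 2 ^ m * m.factorial) * 2, by positivity, fun z hz => ?_⟩
  rcases le_abs.mp hz with h | h
  · obtain ⟨⟨R, hR, hRx⟩, -⟩ := hlap z (by linarith)
    rw [(hres z ⟨R, hR⟩).unique hR, abs_of_pos (by linarith)]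
    refine R.opNorm_le_bound (by positivity) fun x => ?_
    rw [hRx, norm_smul, norm_pow, mul_assoc]
    gcongr
    exact norm_laplace_integral_le hM hSp h x
  · have h' : 1 ≤ (-z).re := by simpa using h
    obtain ⟨-, ⟨R, hR, hRx⟩⟩ := hlap (-z) (by linarith)
    rw [neg_neg] at hR
    rw [(hres z ⟨R, hR⟩).unique hR, ← abs_neg, ← neg_re, abs_of_pos (by linarith)]
    refine R.opNorm_le_bound (by positivity) fun x => ?_
    rw [← norm_neg, hRx, norm_smul, norm_pow, norm_neg, mul_assoc]
    gcongr
    exact norm_laplace_integral_le hM hSm h' x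

theorem norm_inv_pow_smul_le_div_sq {F : Type*} [NormedAddCommGroup F] [NormedSpace ℂ F]
    {R : ℂ → F} {n : ℕ} {C : ℝ} (hC0 : 0 ≤ C)
    (hC : ∀ z : ℂ, 1 ≤ |z.re| → ‖R z‖ ≤ ‖z‖ ^ n * (C / |z.re|)) {j : ℕ} (hj : n + 1 ≤ j) {z : ℂ}
    (hz : 1 ≤ |z.re|) : ‖(z ^ j)⁻¹ • R z‖ ≤ C / z.re ^ 2 := by
  have h1 : 1 ≤ ‖z‖ := hz.trans (abs_re_le_norm z)
  rw [norm_smul, norm_inv, norm_pow]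
  calc (‖z‖ ^ j)⁻¹ * ‖R z‖ ≤ (‖z‖ ^ (n + 1))⁻¹ * (‖z‖ ^ n * (C / |z.re|)) := by
        gcongr
        exact hC z hz
    _ = ‖z‖⁻¹ * (C / |z.re|) := by field_simp; ring
    _ ≤ |z.re|⁻¹ * (C / |z.re|) := by gcongr; exact abs_re_le_norm z
    _ = C / z.re ^ 2 := by rw [← sq_abs]; field_simp

theorem rieszProj_eq_circleOp [CompleteSpace G] {A : G →ₗ.[ℂ] G} {Rres : ℂ → G →L[ℂ] G}
    (hres : ∀ z ∈ resolventSet A, ResolventAt A z (Rres z)) {c : ℂ} {ρ r : ℝ}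
    (hρ : 0 < ρ) (hρr : ρ ≤ r)
    (hU : ∀ z ∈ closedBall c r, z ≠ c → z ∈ resolventSet A) :
    rieszProj Rres c r = circleOp Rres c ρ 0 := by
  have hd := differentiableOn_resolvent hres
  have hmem {z : ℂ} (hz : z ∈ closedBall c r \ ball c ρ) : z ∈ resolventSet A :=
    hU z hz.1 fun h => hz.2 (by simpa [h] using hρ)
  have h := circleIntegral_sub_center_inv_smul_eq_of_differentiable_on_annulus_off_countable
    (c := c) hρ hρr (f := fun z => (z - c) • Rres z) Set.countable_empty ?_ ?_
  · have hcancel {t : ℝ} (ht : 0 < t) : ∮ z in C(c, t), (z - c)⁻¹ • (z - c) • Rres z =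
        ∮ z in C(c, t), Rres z := by
      refine circleIntegral.integral_congr ht.le fun z hz => ?_
      exact inv_smul_smul₀ (sub_ne_zero.mpr (ne_of_mem_sphere hz ht.ne')) _
    rw [hcancel hρ, hcancel (hρ.trans_le hρr)] at h
    rw [rieszProj, h, circleOp]
    simp
  · exact (continuousOn_id.sub continuousOn_const).smul
      (hd.continuousOn.mono fun z hz => hmem hz)
  · intro z hz
    have hz' : z ∈ resolventSet A := hmem ⟨ball_subset_closedBall hz.1.1, fun h =>
      hz.1.2 (ball_subset_closedBall h)⟩
    exact (differentiableAt_id.sub_const c).smul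
      ((hd z hz').differentiableAt ((isOpen_resolventSet A).mem_nhds hz'))

/-- If `A` generates an `n`-times integrated group bounded by `M (1 + |t| ^ m)`
(`m ≥ n`) with discrete spectrum `σ(A) = {iλ_k : k ∈ ℤ, k ≠ 0}` as in the
spectral assumption (so `0 ∈ ρ(A)`, and `A⁻¹ = -(0 - A)⁻¹ = -Rres 0` is bounded),
then there is a bounded operator `Q` with `Q P_k = A^{-(m+1)} P_k` for `k ≥ 1`,
`Q P_k = 0` for `k ≤ -1`, and `Q ∘ Q = Q ∘ A^{-(m+1)}`. -/
theorem exists_halfplane_projection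
    {E : Type*} [NormedAddCommGroup E] [NormedSpace ℂ E] [CompleteSpace E]
    (A : E →ₗ.[ℂ] E)
    (hAclosed : IsClosed (A.graph : Set (E × E)))
    (hAdense : Dense (A.domain : Set E))
    (n m : ℕ) (hnm : n ≤ m) (M : ℝ) (hM : 0 < M)
    (Sp Sm : ℝ → E →L[ℂ] E) (hgen : Generates A n m M Sp Sm)
    (Rres : ℂ → E →L[ℂ] E)
    (hres : ∀ z ∈ resolventSet A, ResolventAt A z (Rres z))
    (lam : ℤ → ℝ)
    (hmono : ∀ j k : ℤ, j ≠ 0 → k ≠ 0 → j < k → lam j < lam k)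
    (hpos : ∀ k : ℤ, 0 < k → 0 < lam k)
    (hneg : ∀ k : ℤ, k < 0 → lam k < 0)
    (hspec : spectrumSet A = {z : ℂ | ∃ k : ℤ, k ≠ 0 ∧ z = Complex.I * (lam k : ℂ)})
    (r : ℤ → ℝ) (hrpos : ∀ k : ℤ, k ≠ 0 → 0 < r k)
    (hrsep : ∀ k : ℤ, k ≠ 0 → ∀ z ∈ spectrumSet A,
      z ∈ Metric.closedBall (Complex.I * (lam k : ℂ)) (r k) → z = Complex.I * (lam k : ℂ)) :
    ∃ Q : E →L[ℂ] E,
      (∀ k : ℤ, 1 ≤ k → ∀ x : E,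
        Q (rieszProj Rres (Complex.I * (lam k : ℂ)) (r k) x) =
          ((-(Rres 0)) ^ (m + 1)) (rieszProj Rres (Complex.I * (lam k : ℂ)) (r k) x)) ∧
      (∀ k : ℤ, k ≤ -1 → ∀ x : E,
        Q (rieszProj Rres (Complex.I * (lam k : ℂ)) (r k) x) = 0) ∧
      Q ∘L Q = Q ∘L ((-(Rres 0)) ^ (m + 1)) := by
  have hU := isOpen_resolventSet A
  have hR := isResolventOn_resolventSet hres
  have hd := differentiableOn_resolvent hres
  obtain ⟨C, hC0, hC⟩ := hgen.exists_norm_resolvent_le hM.le hres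
  have hl1 : 0 < lam 1 := hpos 1 one_pos
  have hge {k : ℤ} (hk : 1 ≤ k) : lam 1 ≤ lam k := by
    rcases hk.eq_or_lt with rfl | h
    · exact le_rfl
    · exact (hmono 1 k one_ne_zero (by omega) h).le
  have hstrip {z : ℂ} (h0 : 0 ≤ z.im) (h1 : z.im < lam 1) : z ∈ resolventSet A := by
    by_contra hz
    have hz' : z ∈ spectrumSet A := hz
    rw [hspec] at hz'
    obtain ⟨k, hk, rfl⟩ := hz'
    rw [I_mul_im, ofReal_re] at h0 h1
    rcases hk.lt_or_gt with h | h
    · exact absurd (hneg k h) (not_lt.mpr h0)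
    · exact absurd (hge h) (not_le.mpr h1)
  have hzero : (0 : ℂ) ∈ resolventSet A := hstrip (by simp) (by simpa using hl1)
  have hline {ε : ℝ} (h0 : 0 < ε) (h1 : ε < lam 1) (s : ℝ) : line ε s ∈ resolventSet A :=
    hstrip (by simpa using h0.le) (by simpa using h1)
  have hfd (j : ℕ) : DifferentiableOn ℂ (fun z : ℂ => (z ^ j)⁻¹ • Rres z)
      (resolventSet A \ {0}) := by
    intro z hz
    have h : DifferentiableAt ℂ (fun z : ℂ => (z ^ j)⁻¹) z :=
      DifferentiableAt.fun_inv (by fun_prop) (pow_ne_zero j hz.2)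
    exact h.differentiableWithinAt.smul ((hd z hz.1).mono Set.sdiff_subset)
  have hbound {j : ℕ} (hj : m + 1 ≤ j) {z : ℂ} (hz : 1 ≤ |z.re|) :
      ‖(z ^ j)⁻¹ • Rres z‖ ≤ C / z.re ^ 2 :=
    norm_inv_pow_smul_le_div_sq hC0 hC (by omega) hz
  have hint {ε : ℝ} (h0 : 0 < ε) (h1 : ε < lam 1) (j : ℕ) (hj : m + 1 ≤ j) :
      Integrable fun s : ℝ => (line ε s ^ j)⁻¹ • Rres (line ε s) := by
    refine integrable_of_norm_le_div_sq (C := C) ?_ fun s hs => ?_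
    · exact (hfd j).continuousOn.comp_continuous (continuous_line ε)
        fun s => ⟨hline h0 h1 s, line_ne_zero h0 s⟩
    · simpa using hbound hj (z := line ε s) (by simpa using hs)
  have hε₁ : 0 < lam 1 / 3 := by positivity
  have hε₂ : 0 < lam 1 / 2 := by positivity
  have hε : lam 1 / 3 < lam 1 / 2 := by linarith
  have hε₁' : lam 1 / 3 < lam 1 := by linarith
  have hε₂' : lam 1 / 2 < lam 1 := by linarith
  have hshift {j : ℕ} (hj : m + 1 ≤ j) :
      lineOp Rres (lam 1 / 3) j = lineOp Rres (lam 1 / 2) j := by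
    rw [lineOp, lineOp, integral_line_eq_of_differentiableOn
      (f := fun z : ℂ => (z ^ j)⁻¹ • Rres z) hε.le ((hfd j).mono fun z hz => ⟨?_, ?_⟩)
      fun z _ => hbound hj]
    · exact hstrip (hε₁.le.trans hz.1) (hz.2.trans_lt hε₂')
    · rintro rfl
      exact absurd hz.1 (by simpa using hl1)
  have hcancel {S T : E →L[ℂ] E} (h : -Rres 0 * S = -Rres 0 * T) : S = T := by
    ext x
    rw [← sub_eq_zero]
    refine (hres 0 hzero).eq_zero_of_apply_eq_zero ?_
    have h1 : -(Rres 0 (S x)) = -(Rres 0 (T x)) := DFunLike.congr_fun h x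
    rw [map_sub, neg_injective h1, sub_self]
  have hQ (i : ℕ) : lineOp Rres (lam 1 / 3) (m + 1) * (-Rres 0) ^ i =
      lineOp Rres (lam 1 / 3) (m + 1 + i) :=
    lineOp_mul_neg_zero_pow hR hε₁ (by omega) hzero (hline hε₁ hε₁') (hint hε₁ hε₁') i
  have hQcomm : Commute (-Rres 0) (lineOp Rres (lam 1 / 3) (m + 1)) :=
    commute_neg_zero_lineOp hR hzero (hline hε₁ hε₁') (hint hε₁ hε₁' _ le_rfl)
  have hmain {k : ℤ} (hk : k ≠ 0) :
      lineOp Rres (lam 1 / 3) (m + 1) * rieszProj Rres (I * lam k) (r k) =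
        above (lam 1 / 3) (I * lam k) •
          ((-Rres 0) ^ (m + 1) * rieszProj Rres (I * lam k) (r k)) := by
    obtain ⟨δ, hδ, hδc, hδε⟩ : ∃ δ > 0, δ < ‖I * (lam k : ℂ)‖ ∧
        δ < |(I * (lam k : ℂ)).im - lam 1 / 3| := by
      suffices h : 0 < min ‖I * (lam k : ℂ)‖ |(I * (lam k : ℂ)).im - lam 1 / 3| from
        (exists_between h).imp fun δ h => ⟨h.1, lt_min_iff.mp h.2⟩
      rw [lt_min_iff, norm_mul, norm_I, one_mul, norm_real, norm_pos_iff, abs_pos, I_mul_im,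
        ofReal_re, sub_ne_zero]
      rcases hk.lt_or_gt with h | h
      · exact ⟨(hneg k h).ne, ((hneg k h).trans hε₁).ne⟩
      · exact ⟨(hpos k h).ne', (hε₁'.trans_le (hge h)).ne'⟩
    have hρ : 0 < min δ (r k) := lt_min hδ (hrpos k hk)
    have hmem : ∀ z ∈ closedBall (I * (lam k : ℂ)) (r k), z ≠ I * lam k → z ∈ resolventSet A :=
      fun z hz hne => by
        by_contra hz'
        exact hne (hrsep k hk z hz' hz)
    have hsphere : sphere (I * (lam k : ℂ)) (min δ (r k)) ⊆ resolventSet A := fun z hz =>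
      hmem z (closedBall_subset_closedBall (min_le_right _ _) (sphere_subset_closedBall hz))
        (ne_of_mem_sphere hz hρ.ne')
    have hc := (min_le_left δ (r k)).trans_lt hδc
    have hPcomm := commute_neg_zero_circleOp hR hρ hzero hsphere hd.continuousOn
    rw [rieszProj_eq_circleOp hres hρ (min_le_right _ _) hmem]
    apply hcancel
    rw [← mul_assoc, hQcomm.eq, ← pow_one (-Rres 0), hQ, pow_one,
      lineOp_mul_circleOp hR hε₁ (by omega) (hline hε₁ hε₁') (hint hε₁ hε₁' _ (by omega)) hρ hc
        ((min_le_left δ (r k)).trans_lt hδε) hsphere hd.continuousOn,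
      ← circleOp_mul_neg_zero_pow hR hρ hzero hc hsphere hd.continuousOn, mul_smul_comm,
      ← mul_assoc, ← pow_succ', (hPcomm.pow_left _).eq]
  refine ⟨lineOp Rres (lam 1 / 3) (m + 1), fun k hk x => ?_, fun k hk x => ?_, ?_⟩
  · have h := hmain (k := k) (by omega)
    rw [above, if_pos (by simpa using hε₁'.trans_le (hge hk)), one_smul] at h
    exact DFunLike.congr_fun h x
  · have h := hmain (k := k) (by omega)
    rw [above, if_neg (by simpa using ((hneg k (by omega)).trans hε₁).le), zero_smul] at h
    exact DFunLike.congr_fun h x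
  · change lineOp Rres (lam 1 / 3) (m + 1) * lineOp Rres (lam 1 / 3) (m + 1) =
      lineOp Rres (lam 1 / 3) (m + 1) * (-Rres 0) ^ (m + 1)
    have h := lineOp_mul_lineOp hR hε₁ hε (i := m + 1) (j := m + 1 + 1) (by omega) (by omega)
      (hline hε₁ hε₁') (hline hε₂ hε₂') (hint hε₁ hε₁' _ le_rfl) (hint hε₂ hε₂' _ (by omega))
    rw [← hshift (by omega), ← hshift (by omega), ← hQ, ← hQ, pow_one, ← hQcomm.eq] at h
    apply hcancel
    rw [← mul_assoc, hQcomm.eq, mul_assoc, h, ← mul_assoc, hQcomm.eq, mul_assoc, ← pow_succ']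

end SpectralDecomp
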